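/- Let p, q > 0 and K, L convex bodies in ℝⁿ containing the origin in their interiors. If the L_p Minkowski inequality for dual quermassintegrals holds, namely (∫_{S^{n-1}} (h_M/h_N)^p dC̃_q(N,·))^{1/p} ≥ Ṽ_q(N)^{1/p} (Ṽ_q(M)/Ṽ_q(N))^{1/q} for all relevant bodies M, N, then the L_p Brunn–Minkowski inequality holds: Ṽ_q((1-λ)K +_p λL)^{p/q} ≥ (1-λ)Ṽ_q(K)^{p/q} + λṼ_q(L)^{p/q} for all λ ∈ [0,1]. -/

import Mathlib

open MeasureTheory Real Filter
open scoped RealInnerProductSpace Pointwise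

noncomputable section

/-- Euclidean space ℝⁿ. -/
abbrev E (n : ℕ) := EuclideanSpace ℝ (Fin n)

/-- The unit sphere S^{n-1} as a subset of ℝⁿ. -/
def sph (n : ℕ) : Set (E n) := Metric.sphere 0 1

/-- Support function of a set K: h_K(u) = sup_{y ∈ K} ⟪u, y⟫. -/
def supp {n : ℕ} (K : Set (E n)) (u : E n) : ℝ := sSup ((fun y => ⟪u, y⟫) '' K)

/-- Radial function of a set K: ρ_K(u) = sup {t ≥ 0 : t • u ∈ K}. -/
def rad {n : ℕ} (K : Set (E n)) (u : E n) : ℝ := sSup {t : ℝ | 0 ≤ t ∧ t • u ∈ K}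

/-- q-th dual quermassintegral Ṽ_q(K) = (1/n) ∫_{S^{n-1}} ρ_K^q dH^{n-1}. -/
def Vq {n : ℕ} (q : ℝ) (K : Set (E n)) : ℝ :=
  (1 / (n : ℝ)) * ∫ u in sph n, rad K u ^ q ∂(μH[((n : ℝ) - 1)])

/-- Wulff shape of a function f on the sphere. -/
def wulff {n : ℕ} (f : E n → ℝ) : Set (E n) :=
  {x | ∀ u : E n, ‖u‖ = 1 → ⟪u, x⟫ ≤ f u}

/-- L_p combination (1-λ)K +_p λL, as Wulff shape of the p-mean of support functions. -/
def lpComb {n : ℕ} (p lam : ℝ) (K L : Set (E n)) : Set (E n) :=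
  wulff fun u => ((1 - lam) * supp K u ^ p + lam * supp L u ^ p) ^ (1 / p)

/-- Convex body containing the origin in its interior. -/
def IsBody {n : ℕ} (K : Set (E n)) : Prop :=
  Convex ℝ K ∧ IsCompact K ∧ (0 : E n) ∈ interior K

open scoped Classical

/-- A choice of outer unit normal to K at the boundary point ρ_K(u)·u. -/
def gaussAt {n : ℕ} (K : Set (E n)) (u : E n) : E n :=
  if h : ∃ v : E n, ‖v‖ = 1 ∧ ⟪v, rad K u • u⟫ = supp K v then h.choose else 0

/-- Integral of g against the q-th dual curvature measure of K:
∫ g dC̃_q(K,·) = (1/n) ∫_{S^{n-1}} g(α_K(u)) ρ_K(u)^q du. -/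
def dualCurvInt {n : ℕ} (q : ℝ) (K : Set (E n)) (g : E n → ℝ) : ℝ :=
  (1 / (n : ℝ)) * ∫ u in sph n, g (gaussAt K u) * rad K u ^ q ∂μH[((n : ℝ) - 1)]

section helpers
variable {n : ℕ} {K : Set (E n)}

lemma IsBody.nhds (hK : IsBody K) : K ∈ nhds (0 : E n) := mem_interior_iff_mem_nhds.1 hK.2.2

lemma IsBody.zero_mem (hK : IsBody K) : (0 : E n) ∈ K := interior_subset hK.2.2

lemma inner_le_supp (hK : IsBody K) (u : E n) {y : E n} (hy : y ∈ K) : ⟪u, y⟫ ≤ supp K u := by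
  refine le_csSup ?_ ⟨y, hy, rfl⟩
  exact (hK.2.1.image (by fun_prop : Continuous fun y : E n => ⟪u, y⟫)).bddAbove

lemma supp_nonneg (hK : IsBody K) (u : E n) : 0 ≤ supp K u := by
  simpa using inner_le_supp hK u hK.zero_mem

lemma supp_pos (hK : IsBody K) {u : E n} (hu : u ≠ 0) : 0 < supp K u := by
  obtain ⟨r, hr, hb⟩ := Metric.mem_nhds_iff.1 hK.nhds
  have hu' : 0 < ‖u‖ := norm_pos_iff.2 hu
  have hm : (r / 2 / ‖u‖) • u ∈ K := by
    apply hb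
    rw [mem_ball_zero_iff, norm_smul, Real.norm_of_nonneg (by positivity)]
    field_simp
    linarith
  have := inner_le_supp hK u hm
  rw [real_inner_smul_right, real_inner_self_eq_norm_sq] at this
  refine lt_of_lt_of_le ?_ this
  positivity

lemma supp_cont (hK : IsBody K) : Continuous (supp K) := by
  unfold supp
  exact hK.2.1.continuous_sSup (f := fun u y : E n => ⟪u, y⟫)
    (by simp only [Function.HasUncurry.uncurry, id]; fun_prop)

lemma gauge_pos' (hK : IsBody K) {u : E n} (hu : u ≠ 0) : 0 < gauge K u :=
  (gauge_pos (absorbent_nhds_zero hK.nhds)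
    ((NormedSpace.isVonNBounded_iff ℝ).2 hK.2.1.isBounded)).2 hu

lemma mem_iff_gauge (hK : IsBody K) (x : E n) : x ∈ K ↔ gauge K x ≤ 1 := by
  rw [gauge_le_one_iff_mem_closure hK.1 hK.nhds, hK.2.1.isClosed.closure_eq]

lemma rad_eq (hK : IsBody K) {u : E n} (hu : u ≠ 0) : rad K u = (gauge K u)⁻¹ := by
  have hg := gauge_pos' hK hu
  have : {t : ℝ | 0 ≤ t ∧ t • u ∈ K} = Set.Icc 0 (gauge K u)⁻¹ := by
    ext t
    simp only [Set.mem_ofPred_eq, Set.mem_Icc]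
    refine and_congr_right fun ht => ?_
    rw [mem_iff_gauge hK, gauge_smul_of_nonneg ht, smul_eq_mul, ← le_div_iff₀ hg, one_div]
  rw [rad, this, csSup_Icc (by positivity)]

lemma rad_pos (hK : IsBody K) {u : E n} (hu : u ≠ 0) : 0 < rad K u := by
  rw [rad_eq hK hu]; exact inv_pos.2 (gauge_pos' hK hu)

lemma rad_mem (hK : IsBody K) {u : E n} (hu : u ≠ 0) : rad K u • u ∈ K := by
  rw [mem_iff_gauge hK, gauge_smul_of_nonneg (rad_pos hK hu).le, rad_eq hK hu, smul_eq_mul,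
    inv_mul_cancel₀ (gauge_pos' hK hu).ne']

lemma inner_le_gauge (hK : IsBody K) (v z : E n) : ⟪v, z⟫ ≤ supp K v * gauge K z := by
  rcases eq_or_ne z 0 with rfl | hz
  · simp
  have h := inner_le_supp hK v (rad_mem hK hz)
  rw [rad_eq hK hz, real_inner_smul_right] at h
  have := gauge_pos' hK hz
  rwa [inv_mul_le_iff₀ this, mul_comm] at h

lemma ne_zero_of_sph {u : E n} (hu : u ∈ sph n) : u ≠ 0 := by
  rintro rfl
  simp [sph] at hu

/-- insertion of a zero coordinate -/
def insZero {m : ℕ} (i : Fin (m + 1)) : (Fin m → ℝ) →ₗ[ℝ] E (m + 1) where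
  toFun y := WithLp.toLp 2 (i.insertNth (α := fun _ => ℝ) 0 y)
  map_add' x y := by
    ext k
    refine Fin.succAboveCases i ?_ (fun j => ?_) k <;> simp
  map_smul' c y := by
    ext k
    refine Fin.succAboveCases i ?_ (fun j => ?_) k <;> simp

lemma eq_insZero {m : ℕ} (i : Fin (m + 1)) (z : E (m + 1)) :
    z = insZero i (fun j => z (i.succAbove j)) + z i • EuclideanSpace.single i (1 : ℝ) := by
  ext k
  refine Fin.succAboveCases i ?_ (fun j => ?_) k <;> simp [insZero]

lemma normalize_lip {x y : E n} (hx : 1 ≤ ‖x‖) (hy : 1 ≤ ‖y‖) :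
    ‖‖x‖⁻¹ • x - ‖y‖⁻¹ • y‖ ≤ 2 * ‖x - y‖ := by
  have hx0 : 0 < ‖x‖ := by linarith
  have hy0 : 0 < ‖y‖ := by linarith
  have h1 : ‖x‖⁻¹ • x - ‖y‖⁻¹ • y = ‖x‖⁻¹ • ((x - y) + ((‖y‖ - ‖x‖) * ‖y‖⁻¹) • y) := by
    rw [smul_add, smul_sub, smul_smul]
    have : ‖x‖⁻¹ * ((‖y‖ - ‖x‖) * ‖y‖⁻¹) = ‖x‖⁻¹ - ‖y‖⁻¹ := by field_simp
    rw [this, sub_smul]; abel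
  have h2 : ‖((‖y‖ - ‖x‖) * ‖y‖⁻¹) • y‖ ≤ ‖x - y‖ := by
    rw [norm_smul, norm_mul, norm_inv, norm_norm, mul_assoc, inv_mul_cancel₀ hy0.ne', mul_one,
      Real.norm_eq_abs, norm_sub_rev x y]
    exact abs_norm_sub_norm_le y x
  rw [h1, norm_smul, norm_inv, norm_norm]
  calc ‖x‖⁻¹ * _ ≤ 1 * (‖x - y‖ + ‖x - y‖) := by
        gcongr
        · exact inv_le_one_of_one_le₀ hx
        · exact (norm_add_le _ _).trans (by gcongr)
    _ = _ := by ring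

/-- the points of the hyperplane chart -/
def chartPt {m : ℕ} (i : Fin (m + 1)) (c : ℝ) (y : Fin m → ℝ) : E (m + 1) :=
  insZero i y + c • EuclideanSpace.single i (1 : ℝ)

lemma chartPt_apply {m : ℕ} (i : Fin (m + 1)) (c : ℝ) (y : Fin m → ℝ) : chartPt i c y i = c := by
  simp [chartPt, insZero]

lemma chartPt_lip {m : ℕ} (i : Fin (m + 1)) (c : ℝ) :
    ∃ C, LipschitzWith C (chartPt (m := m) i c) := by
  refine ⟨‖(insZero i).toContinuousLinearMap‖₊, LipschitzWith.of_dist_le_mul fun x y => ?_⟩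
  have := (insZero i).toContinuousLinearMap.lipschitz.dist_le_mul x y
  simpa [chartPt] using this

lemma one_le_chartPt {m : ℕ} (i : Fin (m + 1)) {c : ℝ} (hc : |c| = 1) (y : Fin m → ℝ) :
    1 ≤ ‖chartPt i c y‖ := by
  have := PiLp.norm_apply_le (chartPt i c y) i
  rwa [chartPt_apply, Real.norm_eq_abs, hc] at this

lemma chart_null {m : ℕ} (i : Fin (m + 1)) {c : ℝ} (hc : |c| = 1) {S : Set (Fin m → ℝ)}
    (hS : volume S = 0) :
    μH[(m : ℝ)] ((fun y => ‖chartPt i c y‖⁻¹ • chartPt i c y) '' S) = 0 := by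
  obtain ⟨C, hC⟩ := chartPt_lip (m := m) i c
  have hl : LipschitzWith (2 * C) (fun y => ‖chartPt i c y‖⁻¹ • chartPt i c y) := by
    refine LipschitzWith.of_dist_le_mul fun x y => ?_
    rw [dist_eq_norm]
    refine (normalize_lip (one_le_chartPt i hc x) (one_le_chartPt i hc y)).trans ?_
    have := hC.dist_le_mul x y
    rw [dist_eq_norm] at this
    push_cast
    linarith
  have h := hl.hausdorffMeasure_image_le (d := (m : ℝ)) (by positivity) S
  have h0 : μH[(m : ℝ)] S = 0 := by
    have := hausdorffMeasure_pi_real (ι := Fin m)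
    rw [Fintype.card_fin] at this
    rw [this, hS]
  rw [h0, mul_zero] at h
  exact le_antisymm h zero_le

lemma subgrad_unique {m : ℕ} {g : E (m + 1) → ℝ} (i : Fin (m + 1)) {c : ℝ} (hc : c ≠ 0)
    {y : Fin m → ℝ} (hd : DifferentiableAt ℝ (fun y => g (chartPt i c y)) y)
    {w w' : E (m + 1)} (hw : ∀ z, ⟪w, z⟫ ≤ g z) (hw' : ∀ z, ⟪w', z⟫ ≤ g z)
    (he : ⟪w, chartPt i c y⟫ = g (chartPt i c y)) (he' : ⟪w', chartPt i c y⟫ = g (chartPt i c y)) :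
    w = w' := by
  have key : ∀ w : E (m + 1), (∀ z, ⟪w, z⟫ ≤ g z) → ⟪w, chartPt i c y⟫ = g (chartPt i c y) →
      ∀ d, ⟪w, insZero i d⟫ = fderiv ℝ (fun y => g (chartPt i c y)) y d := by
    intro w hw he d
    let A : (Fin m → ℝ) →L[ℝ] ℝ := (innerSL ℝ w).comp (insZero i).toContinuousLinearMap
    have hA : HasFDerivAt (fun y => g (chartPt i c y) - (A y + ⟪w, c • EuclideanSpace.single i (1 : ℝ)⟫))
        (fderiv ℝ (fun y => g (chartPt i c y)) y - A) y :=
      hd.hasFDerivAt.sub (A.hasFDerivAt.add_const _)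
    have hAy : ∀ y, A y + ⟪w, c • EuclideanSpace.single i (1 : ℝ)⟫ = ⟪w, chartPt i c y⟫ := by
      intro y
      simp [A, chartPt, inner_add_right]
    have hmin : IsLocalMin (fun y => g (chartPt i c y) - (A y + ⟪w, c • EuclideanSpace.single i (1 : ℝ)⟫)) y := by
      refine Filter.Eventually.of_forall fun x => ?_
      simp only [hAy]
      have := hw (chartPt i c x)
      linarith
    have h0 := hmin.hasFDerivAt_eq_zero hA
    have := congrArg (fun T => T d) h0
    simp [A] at this
    linarith
  have hk : ∀ d, ⟪w - w', insZero i d⟫ = 0 := by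
    intro d
    rw [inner_sub_left, key w hw he, key w' hw' he', sub_self]
  have hx : ⟪w - w', chartPt i c y⟫ = 0 := by
    rw [inner_sub_left, he, he', sub_self]
  have hs : ⟪w - w', EuclideanSpace.single i (1 : ℝ)⟫ = 0 := by
    rw [chartPt, inner_add_right, hk, zero_add, real_inner_smul_right] at hx
    exact (mul_eq_zero.1 hx).resolve_left hc
  have : ⟪w - w', w - w'⟫ = 0 := by
    nth_rw 2 [eq_insZero i (w - w')]
    rw [inner_add_right, hk, real_inner_smul_right, hs]; simp
  exact sub_eq_zero.1 (inner_self_eq_zero.1 this)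

lemma normal_unique_ae (hK : IsBody K) :
    ∀ᵐ u ∂(μH[((n : ℝ) - 1)]).restrict (sph n), ∀ v v' : E n, ‖v‖ = 1 → ‖v'‖ = 1 →
      ⟪v, rad K u • u⟫ = supp K v → ⟪v', rad K u • u⟫ = supp K v' → v = v' := by
  rw [ae_restrict_iff' (by exact Metric.isClosed_sphere.measurableSet)]
  cases n with
  | zero =>
    refine Filter.Eventually.of_forall fun u hu => absurd (Subsingleton.elim u 0) (ne_zero_of_sph hu)
  | succ m =>
  have hm : (((m + 1 : ℕ) : ℝ) - 1) = m := by push_cast; ring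
  rw [hm]
  obtain ⟨C, hC⟩ := hK.1.lipschitz_gauge hK.nhds
  let bad : Fin (m + 1) → ℝ → Set (Fin m → ℝ) := fun i c =>
    {y | ¬ DifferentiableAt ℝ (fun y => gauge K (chartPt i c y)) y}
  have hbad : ∀ i c, volume (bad i c) = 0 := by
    intro i c
    obtain ⟨C', hC'⟩ := chartPt_lip (m := m) i c
    exact (hC.comp hC').ae_differentiableAt (μ := volume)
  let im : Fin (m + 1) → ℝ → Set (E (m + 1)) := fun i c =>
    (fun y => ‖chartPt i c y‖⁻¹ • chartPt i c y) '' bad i c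
  have hnull : μH[(m : ℝ)] (⋃ i, (im i 1 ∪ im i (-1))) = 0 := by
    rw [measure_iUnion_null_iff]
    intro i
    exact measure_union_null (chart_null i (by simp) (hbad i 1)) (chart_null i (by simp) (hbad i (-1)))
  rw [ae_iff]
  refine measure_mono_null ?_ hnull
  intro u hu
  by_contra hnot
  apply hu
  intro hus v v' hv hv' he he'
  have hu0 := ne_zero_of_sph hus
  have hun : ‖u‖ = 1 := by simpa [sph] using hus
  obtain ⟨i, hi⟩ : ∃ i, u i ≠ 0 := by
    by_contra! h
    exact hu0 (by ext i; simpa using h i)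
  have hai : 0 < |u i| := abs_pos.2 hi
  -- the chart point
  set c : ℝ := |u i|⁻¹ * u i with hc
  have hc1 : c = 1 ∨ c = -1 := by
    rcases lt_or_gt_of_ne hi with h | h
    · right; rw [hc, abs_of_neg h]; field_simp
    · left; rw [hc, abs_of_pos h]; field_simp
  have hc0 : c ≠ 0 := by rcases hc1 with h | h <;> rw [h] <;> norm_num
  let y : Fin m → ℝ := fun j => |u i|⁻¹ * u (i.succAbove j)
  have hcy : chartPt i c y = |u i|⁻¹ • u := by
    have := eq_insZero i (|u i|⁻¹ • u)
    rw [this]; simp [chartPt, y, hc]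
  have hnorm : ‖chartPt i c y‖⁻¹ • chartPt i c y = u := by
    rw [hcy, norm_smul, hun, norm_inv, norm_of_nonneg hai.le, smul_smul]
    simp [hai.ne']
  have hyd : DifferentiableAt ℝ (fun y => gauge K (chartPt i c y)) y := by
    by_contra hyb
    apply hnot
    refine Set.mem_iUnion.2 ⟨i, ?_⟩
    rcases hc1 with h | h
    · left; rw [← h]; exact ⟨y, hyb, hnorm⟩
    · right; rw [← h]; exact ⟨y, hyb, hnorm⟩
  have hne : ∀ v : E (m + 1), ‖v‖ = 1 → v ≠ 0 := by
    rintro v hv rfl; simp at hv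
  have hle : ∀ v : E (m + 1), ‖v‖ = 1 → ∀ z, ⟪(supp K v)⁻¹ • v, z⟫ ≤ gauge K z := by
    intro v hv z
    have := supp_pos hK (hne v hv)
    rw [real_inner_smul_left, inv_mul_le_iff₀ this]
    exact inner_le_gauge hK v z
  have heq : ∀ v : E (m + 1), ‖v‖ = 1 → ⟪v, rad K u • u⟫ = supp K v →
      ⟪(supp K v)⁻¹ • v, chartPt i c y⟫ = gauge K (chartPt i c y) := by
    intro v hv he
    have := supp_pos hK (hne v hv)
    have hg := gauge_pos' hK hu0
    rw [hcy, gauge_smul_of_nonneg (by positivity), real_inner_smul_left, real_inner_smul_right]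
    rw [real_inner_smul_right, rad_eq hK hu0] at he
    have : ⟪v, u⟫ = supp K v * gauge K u := by rw [← he]; field_simp
    rw [this, smul_eq_mul]; field_simp
  have hw := subgrad_unique i hc0 hyd (hle v hv) (hle v' hv') (heq v hv he) (heq v' hv' he')
  have hs := supp_pos hK (hne v hv)
  have hs' := supp_pos hK (hne v' hv')
  have hn := congrArg norm hw
  rw [norm_smul, norm_smul, hv, hv', norm_inv, norm_inv, norm_of_nonneg hs.le,
    norm_of_nonneg hs'.le, mul_one, mul_one] at hn
  rw [hn] at hw
  exact smul_right_injective _ (inv_pos.2 hs').ne' hw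

lemma exists_lower {g : E n → ℝ} (hg : Continuous g) (hpos : ∀ v : E n, ‖v‖ = 1 → 0 < g v) :
    ∃ ε > 0, ∀ v : E n, ‖v‖ = 1 → ε ≤ g v := by
  have hc : ContinuousOn (fun v => (g v)⁻¹) (Metric.sphere (0 : E n) 1) :=
    hg.continuousOn.inv₀ fun v hv => (hpos v (by simpa using hv)).ne'
  obtain ⟨C, hC⟩ := (isCompact_sphere (0 : E n) 1).exists_bound_of_continuousOn hc
  refine ⟨(max C 1)⁻¹, by positivity, fun v hv => ?_⟩
  have h1 := hC v (by simpa using hv)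
  have h2 := hpos v hv
  rw [Real.norm_of_nonneg (by positivity)] at h1
  exact inv_le_of_inv_le₀ h2 (h1.trans (le_max_left _ _))

lemma exists_upper {g : E n → ℝ} (hg : Continuous g) :
    ∃ C > 0, ∀ v : E n, ‖v‖ = 1 → g v ≤ C := by
  obtain ⟨C, hC⟩ := (isCompact_sphere (0 : E n) 1).exists_bound_of_continuousOn hg.continuousOn
  refine ⟨max C 1, by positivity, fun v hv => ?_⟩
  exact (le_abs_self _).trans ((hC v (by simpa using hv)).trans (le_max_left _ _))

lemma wulff_body {f : E n → ℝ} (hf : Continuous f) (hpos : ∀ v : E n, ‖v‖ = 1 → 0 < f v) :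
    IsBody (wulff f) := by
  have hclosed : IsClosed (wulff f) := by
    have : wulff f = ⋂ u : E n, ⋂ _ : ‖u‖ = 1, {x | ⟪u, x⟫ ≤ f u} := by
      ext x; simp [wulff]
    rw [this]
    refine isClosed_iInter fun u => isClosed_iInter fun _ => ?_
    exact isClosed_le (by fun_prop) continuous_const
  refine ⟨?_, ?_, ?_⟩
  · intro x hx y hy a b ha hb hab u hu
    have h1 := mul_le_mul_of_nonneg_left (hx u hu) ha
    have h2 := mul_le_mul_of_nonneg_left (hy u hu) hb
    rw [inner_add_right, real_inner_smul_right, real_inner_smul_right]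
    calc _ ≤ a * f u + b * f u := add_le_add h1 h2
      _ = f u := by rw [← add_mul, hab, one_mul]
  · obtain ⟨C, hC0, hC⟩ := exists_upper hf
    refine Metric.isCompact_of_isClosed_isBounded hclosed
      ((Metric.isBounded_closedBall (x := (0 : E n)) (r := C)).subset fun x hx => ?_)
    rw [mem_closedBall_zero_iff]
    rcases eq_or_ne x 0 with rfl | h0
    · simpa using hC0.le
    have hx0 : 0 < ‖x‖ := norm_pos_iff.2 h0
    have hu : ‖‖x‖⁻¹ • x‖ = 1 := by
      rw [norm_smul, norm_inv, norm_norm, inv_mul_cancel₀ hx0.ne']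
    have h := (hx _ hu).trans (hC _ hu)
    rw [real_inner_smul_left, real_inner_self_eq_norm_sq] at h
    calc ‖x‖ = ‖x‖⁻¹ * ‖x‖ ^ 2 := by field_simp
      _ ≤ C := h
  · obtain ⟨ε, hε, h⟩ := exists_lower hf hpos
    rw [mem_interior_iff_mem_nhds]
    refine Filter.mem_of_superset (Metric.ball_mem_nhds 0 hε) fun x hx u hu => ?_
    rw [mem_ball_zero_iff] at hx
    have := real_inner_le_norm u x
    rw [hu, one_mul] at this
    exact this.trans (hx.le.trans (h u hu))

lemma supp_wulff_le {f : E n → ℝ} (hb : IsBody (wulff f)) {v : E n} (hv : ‖v‖ = 1) :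
    supp (wulff f) v ≤ f v := by
  refine csSup_le ⟨_, 0, hb.zero_mem, rfl⟩ ?_
  rintro _ ⟨y, hy, rfl⟩
  exact hy v hv

lemma wulff_touch {f : E n → ℝ} (hf : Continuous f) (hb : IsBody (wulff f)) {u : E n}
    (hu : u ∈ sph n) :
    ∃ v : E n, ‖v‖ = 1 ∧ ⟪v, rad (wulff f) u • u⟫ = supp (wulff f) v ∧ supp (wulff f) v = f v := by
  have hu0 := ne_zero_of_sph hu
  have hun : ‖u‖ = 1 := by simpa [sph] using hu
  have hx := rad_mem hb hu0
  obtain ⟨v, hv, hle⟩ : ∃ v : E n, ‖v‖ = 1 ∧ f v ≤ ⟪v, rad (wulff f) u • u⟫ := by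
    by_contra! hcon
    obtain ⟨ε, hε, h⟩ := exists_lower (g := fun v => f v - ⟪v, rad (wulff f) u • u⟫)
      (by fun_prop) (fun v hv => sub_pos.2 (hcon v hv))
    have hmem : (rad (wulff f) u + ε) • u ∈ wulff f := by
      intro v hv
      have h1 := h v hv
      have h2 := real_inner_le_norm v u
      rw [hv, hun, mul_one] at h2
      rw [add_smul, inner_add_right, real_inner_smul_right v u ε]
      have := mul_le_mul_of_nonneg_left h2 hε.le
      linarith
    have hr := rad_pos hb hu0
    have hg := gauge_pos' hb hu0
    rw [mem_iff_gauge hb, gauge_smul_of_nonneg (by positivity), smul_eq_mul, rad_eq hb hu0, add_mul,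
      inv_mul_cancel₀ hg.ne'] at hmem
    have := mul_pos hε hg
    linarith
  have h1 := inner_le_supp hb v hx
  have h2 := supp_wulff_le hb hv
  exact ⟨v, hv, by linarith, by linarith⟩

lemma gauss_wulff_ae {f : E n → ℝ} (hf : Continuous f) (hb : IsBody (wulff f)) :
    ∀ᵐ u ∂(μH[((n : ℝ) - 1)]).restrict (sph n),
      ‖gaussAt (wulff f) u‖ = 1 ∧ supp (wulff f) (gaussAt (wulff f) u) = f (gaussAt (wulff f) u) := by
  filter_upwards [normal_unique_ae hb,
    ae_restrict_mem (by exact Metric.isClosed_sphere.measurableSet)] with u huniq hu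
  obtain ⟨v, hv, he, hs⟩ := wulff_touch hf hb hu
  have hex : ∃ v : E n, ‖v‖ = 1 ∧ ⟪v, rad (wulff f) u • u⟫ = supp (wulff f) v := ⟨v, hv, he⟩
  have hg : gaussAt (wulff f) u = hex.choose := by
    unfold gaussAt; rw [dif_pos hex]
  have hsp := hex.choose_spec
  rw [← hg] at hsp
  have : gaussAt (wulff f) u = v := huniq _ _ hsp.1 hv hsp.2 he
  rw [this]
  exact ⟨hv, hs⟩

lemma rad_bounds {q : ℝ} (hq : 0 < q) (hK : IsBody K) :
    ∃ a > 0, ∃ b, ∀ u ∈ sph n, a ≤ rad K u ^ q ∧ rad K u ^ q ≤ b := by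
  have hc := continuous_gauge hK.1 hK.nhds
  obtain ⟨C, hC0, hC⟩ := exists_upper hc
  obtain ⟨ε, hε, h⟩ := exists_lower hc
    (fun v hv => gauge_pos' hK (ne_zero_of_sph (by simpa [sph] using hv)))
  refine ⟨(C⁻¹) ^ q, by positivity, (ε⁻¹) ^ q, fun u hu => ?_⟩
  have hu0 := ne_zero_of_sph hu
  have hg := gauge_pos' hK hu0
  have hun : ‖u‖ = 1 := by simpa [sph] using hu
  rw [rad_eq hK hu0]
  constructor
  · exact Real.rpow_le_rpow (by positivity) (inv_anti₀ hg (hC u hun)) hq.le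
  · exact Real.rpow_le_rpow (by positivity) (inv_anti₀ hε (h u hun)) hq.le

lemma rad_aesm (q : ℝ) (hK : IsBody K) :
    AEStronglyMeasurable (fun u => rad K u ^ q) ((μH[((n : ℝ) - 1)]).restrict (sph n)) := by
  have hm : Measurable fun u : E n => ((gauge K u)⁻¹) ^ q :=
    ((continuous_gauge hK.1 hK.nhds).measurable.inv).pow_const q
  refine hm.aestronglyMeasurable.congr ?_
  filter_upwards [ae_restrict_mem (by exact Metric.isClosed_sphere.measurableSet)] with u hu
  rw [rad_eq hK (ne_zero_of_sph hu)]

lemma Vq_dichotomy {q : ℝ} (hq : 0 < q) :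
    (∀ K : Set (E n), IsBody K → Vq q K = 0) ∨ (∀ K : Set (E n), IsBody K → 0 < Vq q K) := by
  rcases Nat.eq_zero_or_pos n with rfl | hn
  · left; intro K _; simp [Vq]
  set μ := (μH[((n : ℝ) - 1)] : Measure (E n)).restrict (sph n) with hμ
  have hmem : ∀ᵐ u ∂μ, u ∈ sph n :=
    ae_restrict_mem (by exact Metric.isClosed_sphere.measurableSet)
  by_cases h0 : μ = 0
  · left; intro K _; simp [Vq, ← hμ, h0]
  by_cases hfin : IsFiniteMeasure μ
  · right
    intro K hK
    obtain ⟨a, ha, b, hab⟩ := rad_bounds hq hK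
    have hint : Integrable (fun u => rad K u ^ q) μ := by
      refine Integrable.of_bound (rad_aesm q hK) b ?_
      filter_upwards [hmem] with u hu
      rw [Real.norm_of_nonneg (ha.le.trans (hab u hu).1)]
      exact (hab u hu).2
    have h1 : ∫ _, a ∂μ ≤ ∫ u, rad K u ^ q ∂μ := by
      refine integral_mono_ae (integrable_const a) hint ?_
      filter_upwards [hmem] with u hu using (hab u hu).1
    have h2 : 0 < ∫ _ : E n, a ∂μ := by
      rw [integral_const, smul_eq_mul]
      refine mul_pos ?_ ha
      rw [measureReal_def]
      exact ENNReal.toReal_pos (by simpa using h0) (measure_ne_top _ _)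
    have : (0 : ℝ) < n := by exact_mod_cast hn
    exact mul_pos (by positivity) (h2.trans_le h1)
  · left
    intro K hK
    obtain ⟨a, ha, b, hab⟩ := rad_bounds hq hK
    have : ∫ u, rad K u ^ q ∂μ = 0 := by
      refine integral_undef fun hint => hfin ?_
      have : Integrable (fun _ : E n => a) μ := by
        refine hint.mono aestronglyMeasurable_const ?_
        filter_upwards [hmem] with u hu
        rw [Real.norm_of_nonneg ha.le, Real.norm_of_nonneg (ha.le.trans (hab u hu).1)]
        exact (hab u hu).1
      exact (integrable_const_iff.1 this).resolve_left ha.ne'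
    rw [Vq, ← hμ, this, mul_zero]

end helpers

/-- the L_p Minkowski inequality for dual quermassintegrals implies the
L_p Brunn–Minkowski inequality for dual quermassintegrals. -/
theorem stmt6 {n : ℕ} (p q : ℝ) (hp : 0 < p) (hq : 0 < q)
    (K L : Set (E n)) (hK : IsBody K) (hL : IsBody L)
    (hMink : ∀ M N : Set (E n), IsBody M → IsBody N →
      Vq q N ^ ((1:ℝ) / p) * (Vq q M / Vq q N) ^ ((1:ℝ) / q) ≤
        (dualCurvInt q N (fun v => (supp M v / supp N v) ^ p)) ^ ((1:ℝ) / p)) :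
    ∀ lam ∈ Set.Icc (0:ℝ) 1,
      (1 - lam) * Vq q K ^ (p / q) + lam * Vq q L ^ (p / q) ≤
        Vq q (lpComb p lam K L) ^ (p / q) := by
  intro lam hlam
  obtain ⟨hl0, hl1⟩ := hlam
  have hl1' : 0 ≤ 1 - lam := by linarith
  set f : E n → ℝ := fun u => ((1 - lam) * supp K u ^ p + lam * supp L u ^ p) ^ (1 / p) with hf
  have hQdef : lpComb p lam K L = wulff f := rfl
  have hsum : ∀ v : E n, ‖v‖ = 1 → 0 < (1 - lam) * supp K v ^ p + lam * supp L v ^ p := by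
    intro v hv
    have hv0 : v ≠ 0 := by rintro rfl; simp at hv
    have h1 := Real.rpow_pos_of_pos (supp_pos hK hv0) p
    have h2 := Real.rpow_pos_of_pos (supp_pos hL hv0) p
    rcases hl0.eq_or_lt with h | h
    · rw [← h]; simpa using h1
    · have := mul_pos h h2
      have := mul_nonneg hl1' h1.le
      linarith
  have hfpos : ∀ v : E n, ‖v‖ = 1 → 0 < f v := fun v hv => Real.rpow_pos_of_pos (hsum v hv) _
  have hfc : Continuous f := by
    have h1 := (supp_cont hK).rpow_const (p := p) (fun _ => Or.inr hp.le)
    have h2 := (supp_cont hL).rpow_const (p := p) (fun _ => Or.inr hp.le)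
    exact ((continuous_const.mul h1).add (continuous_const.mul h2)).rpow_const
      (fun _ => Or.inr (by positivity))
  have hQ : IsBody (wulff f) := wulff_body hfc hfpos
  rw [hQdef]
  have hpq : 0 < p / q := div_pos hp hq
  rcases Vq_dichotomy (n := n) hq with hz | hpos
  · rw [hz K hK, hz L hL, hz _ hQ, Real.zero_rpow hpq.ne']; simp
  set Q := wulff f with hQd
  have hV := hpos Q hQ
  set μ := (μH[((n : ℝ) - 1)] : Measure (E n)).restrict (sph n) with hμ
  have hmem : ∀ᵐ u ∂μ, u ∈ sph n :=
    ae_restrict_mem (by exact Metric.isClosed_sphere.measurableSet)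
  -- consequences of the Minkowski inequality
  have hM : ∀ M : Set (E n), IsBody M →
      Integrable (fun u => (supp M (gaussAt Q u) / supp Q (gaussAt Q u)) ^ p * rad Q u ^ q) μ ∧
      Vq q Q * (Vq q M / Vq q Q) ^ (p / q) ≤
        dualCurvInt q Q (fun v => (supp M v / supp Q v) ^ p) := by
    intro M hMb
    have h := hMink M Q hMb hQ
    have hVM := hpos M hMb
    have hLpos : 0 < Vq q Q ^ ((1:ℝ) / p) * (Vq q M / Vq q Q) ^ ((1:ℝ) / q) := by positivity
    constructor
    · by_contra hni
      have : dualCurvInt q Q (fun v => (supp M v / supp Q v) ^ p) = 0 := by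
        rw [dualCurvInt, ← hμ, integral_undef hni, mul_zero]
      rw [this, Real.zero_rpow (by positivity)] at h
      linarith
    · have hD : 0 ≤ dualCurvInt q Q (fun v => (supp M v / supp Q v) ^ p) := by
        refine mul_nonneg (by positivity) (integral_nonneg_of_ae ?_)
        rw [← hμ]
        filter_upwards [hmem] with u hu
        exact mul_nonneg (Real.rpow_nonneg (div_nonneg (supp_nonneg hMb _) (supp_nonneg hQ _)) _)
          (Real.rpow_nonneg (rad_pos hQ (ne_zero_of_sph hu)).le _)
      have h' := Real.rpow_le_rpow hLpos.le h hp.le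
      rw [Real.mul_rpow (by positivity) (by positivity), ← Real.rpow_mul hV.le,
        ← Real.rpow_mul (by positivity), ← Real.rpow_mul hD, one_div_mul_cancel hp.ne',
        Real.rpow_one, Real.rpow_one, one_div_mul_eq_div] at h'
      exact h'
  obtain ⟨hiK, hmK⟩ := hM K hK
  obtain ⟨hiL, hmL⟩ := hM L hL
  have hsplit : Vq q Q = (1 - lam) * dualCurvInt q Q (fun v => (supp K v / supp Q v) ^ p) +
      lam * dualCurvInt q Q (fun v => (supp L v / supp Q v) ^ p) := by
    have hint : ∫ u, rad Q u ^ q ∂μ =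
        (1 - lam) * ∫ u, (supp K (gaussAt Q u) / supp Q (gaussAt Q u)) ^ p * rad Q u ^ q ∂μ +
        lam * ∫ u, (supp L (gaussAt Q u) / supp Q (gaussAt Q u)) ^ p * rad Q u ^ q ∂μ := by
      rw [← integral_const_mul, ← integral_const_mul,
        ← integral_add (hiK.const_mul _) (hiL.const_mul _)]
      refine integral_congr_ae ?_
      filter_upwards [gauss_wulff_ae hfc hQ] with u hu
      rw [← hQd] at hu
      obtain ⟨h1, h2⟩ := hu
      set v := gaussAt Q u
      have hs := hsum v h1
      have hQp : supp Q v ^ p = (1 - lam) * supp K v ^ p + lam * supp L v ^ p := by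
        rw [h2, hf]
        simp only
        rw [← Real.rpow_mul hs.le, one_div_mul_cancel hp.ne', Real.rpow_one]
      rw [Real.div_rpow (supp_nonneg hK _) (supp_nonneg hQ _),
        Real.div_rpow (supp_nonneg hL _) (supp_nonneg hQ _)]
      have hne : supp Q v ^ p ≠ 0 := by rw [hQp]; exact hs.ne'
      have : (1 - lam) * (supp K v ^ p / supp Q v ^ p * rad Q u ^ q) +
          lam * (supp L v ^ p / supp Q v ^ p * rad Q u ^ q) =
          ((1 - lam) * supp K v ^ p + lam * supp L v ^ p) / supp Q v ^ p * rad Q u ^ q := by ring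
      rw [this, ← hQp, div_self hne, one_mul]
    rw [Vq, dualCurvInt, dualCurvInt, ← hμ, hint]
    ring
  have h1 := mul_le_mul_of_nonneg_left hmK hl1'
  have h2 := mul_le_mul_of_nonneg_left hmL hl0
  have h3 := add_le_add h1 h2
  rw [← hsplit, Real.div_rpow (hpos K hK).le hV.le, Real.div_rpow (hpos L hL).le hV.le] at h3
  have hVp : 0 < Vq q Q ^ (p / q) := by positivity
  have h4 : Vq q Q * (((1 - lam) * Vq q K ^ (p / q) + lam * Vq q L ^ (p / q)) / Vq q Q ^ (p / q))
      ≤ Vq q Q * 1 := by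
    rw [mul_one]
    refine le_trans (le_of_eq ?_) h3
    ring
  have h5 := le_of_mul_le_mul_left h4 hV
  rwa [div_le_one hVp] at h5
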